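/- Let A(t) be an n×l real matrix function of class C¹ on [a,b] with l ≤ n, and set B(t) = A(t)ᵀA(t). Suppose det B(t) ≠ 0 for t ∈ (a,b), det B(a) = 0, and there exists h_a > 0 such that det B(a+t) = h_a² t² + o(t²) as t → 0+. Then the function μA(t) = min_{|v|=1} |A(t)v| is continuously differentiable on [a, a+δ) for some δ > 0, and its right derivative at t = a equals h_a/√Λ_a, where Λ_a is the product of the nonzero eigenvalues of B(a). -/

import Mathlib

open Set Filter Asymptotics Topology MeasureTheory Matrix

/-- Euclidean norm of a vector in `ℝˡ`. -/
noncomputable def euclNorm {l : ℕ} (v : Fin l → ℝ) : ℝ := Real.sqrt (∑ i, v i ^ 2)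

/-- The mininorm `μ(A) = min_{|v| = 1} |Av|` of an `n × l` matrix. -/
noncomputable def muNorm {n l : ℕ} (M : Matrix (Fin n) (Fin l) ℝ) : ℝ :=
  sInf ((fun v => euclNorm (M.mulVec v)) '' {v : Fin l → ℝ | euclNorm v = 1})

theorem norm_c1 {E : Type*} [NormedAddCommGroup E] [InnerProductSpace ℝ E] (N : ℝ → E) (a : ℝ)
    (hN : ContDiffWithinAt ℝ 1 N (Ici a) a) (h0 : N a = 0)
    (h1 : ¬ HasDerivWithinAt N 0 (Ici a) a) :
    ContDiffWithinAt ℝ 1 (fun t => ‖N t‖) (Ici a) a := by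
  obtain ⟨u, hu, -, hNu⟩ := hN.contDiffOn (m := 1) le_rfl (by simp)
  rw [insert_eq_of_mem self_mem_Ici] at hu
  obtain ⟨N', hN'⟩ : ∃ N', HasDerivWithinAt N N' (Ici a) a :=
    ⟨_, (hN.differentiableWithinAt (by simp)).hasDerivWithinAt⟩
  have hN'0 : N' ≠ 0 := by rintro rfl; exact h1 hN'
  have hne : ∀ᶠ t in 𝓝[>] a, N t ≠ 0 := by
    have := (hN'.mono (Ioi_subset_Ici_self)).eventually_ne (c := 0) hN'0
    simpa using this
  obtain ⟨c1, hc1, hu1⟩ := mem_nhdsGE_iff_exists_Ico_subset.1 hu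
  obtain ⟨c2, hc2, hu2⟩ := mem_nhdsGT_iff_exists_Ioo_subset.1 hne
  set c := min c1 c2 with hc
  have hac : a < c := lt_min hc1 hc2
  set s := Ico a c with hs
  have hNs : ContDiffOn ℝ 1 N s := hNu.mono (fun t ht => hu1 ⟨ht.1, ht.2.trans_le (min_le_left _ _)⟩)
  have hnes : ∀ t ∈ Ioo a c, N t ≠ 0 := fun t ht => hu2 ⟨ht.1, ht.2.trans_le (min_le_right _ _)⟩
  have hsn : s ∈ 𝓝[≥] a := Ico_mem_nhdsGE hac
  have hsu : UniqueDiffOn ℝ s := uniqueDiffOn_Ico a c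
  have has : a ∈ s := ⟨le_rfl, hac⟩
  have hN's : HasDerivWithinAt N N' s a := hN'.mono Ico_subset_Ici_self
  have hcont : ContinuousOn (derivWithin N s) s := hNs.continuousOn_derivWithin hsu le_rfl
  have hsl : Tendsto (fun t => (t - a)⁻¹ • N t) (𝓝[>] a) (𝓝 N') := by
    have := hasDerivWithinAt_iff_tendsto_slope.1 hN'
    rw [Ici_sdiff_left] at this
    refine this.congr fun t => ?_
    simp [slope, h0]
  have hda : HasDerivWithinAt (fun t => ‖N t‖) ‖N'‖ s a := by
    rw [hasDerivWithinAt_iff_tendsto_slope]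
    refine Tendsto.mono_left ?_ (nhdsWithin_mono a (show s \ {a} ⊆ Ioi a from fun t ht =>
      lt_of_le_of_ne ht.1.1 (fun h => ht.2 h.symm)))
    refine hsl.norm.congr' ?_
    filter_upwards [self_mem_nhdsWithin] with t ht
    have : 0 < t - a := sub_pos.2 ht
    simp [slope, h0, norm_smul, abs_of_pos this]
  have hdt : ∀ t ∈ Ioo a c, HasDerivWithinAt (fun t => ‖N t‖)
      (inner ℝ (N t) (derivWithin N s t) / ‖N t‖) s t := by
    intro t ht
    have hd : HasDerivWithinAt N (derivWithin N s t) s t :=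
      (hNs.differentiableOn (by simp) t (Ioo_subset_Ico_self ht)).hasDerivWithinAt
    have h2 := hd.norm_sq.sqrt (by simpa using hnes t ht)
    simp only [Real.sqrt_sq (norm_nonneg _)] at h2
    convert h2 using 1
    field_simp
  have key : ContDiffOn ℝ 1 (fun t => ‖N t‖) s := by
    rw [contDiffOn_one_iff_derivWithin hsu]
    refine ⟨fun t ht => ?_, fun t ht => ?_⟩
    · rcases eq_or_lt_of_le ht.1 with rfl | h
      · exact hda.differentiableWithinAt
      · exact (hdt t ⟨h, ht.2⟩).differentiableWithinAt
    · rcases eq_or_lt_of_le ht.1 with rfl | h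
      · rw [← continuousWithinAt_sdiff_self]
        unfold ContinuousWithinAt
        rw [hda.derivWithin (hsu _ has)]
        have hsub : s \ {a} ⊆ Ioi a := fun t ht =>
          lt_of_le_of_ne ht.1.1 (fun h => ht.2 h.symm)
        have h3 : Tendsto (fun t => (t - a)⁻¹ • N t) (𝓝[s \ {a}] a) (𝓝 N') :=
          hsl.mono_left (nhdsWithin_mono a hsub)
        have h4 : Tendsto (derivWithin N s) (𝓝[s \ {a}] a) (𝓝 N') := by
          have := hcont a has
          unfold ContinuousWithinAt at this
          rw [hN's.derivWithin (hsu _ has)] at this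
          exact this.mono_left (nhdsWithin_mono a sdiff_subset)
        have h5 := (h3.inner h4).div h3.norm (by simpa using hN'0)
        have h6 : inner ℝ N' N' / ‖N'‖ = ‖N'‖ := by
          rw [real_inner_self_eq_norm_sq]; field_simp
        rw [h6] at h5
        refine h5.congr' ?_
        filter_upwards [self_mem_nhdsWithin] with t ht
        have hta : a < t := hsub ht
        rw [(hdt t ⟨hta, ht.1.2⟩).derivWithin (hsu _ ht.1)]
        have : 0 < t - a := sub_pos.2 hta
        have h7 : ‖N t‖ ≠ 0 := by simpa using hnes t ⟨hta, ht.1.2⟩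
        simp only [Pi.div_apply, norm_smul, real_inner_smul_left, norm_inv, Real.norm_eq_abs, abs_of_pos this]
        field_simp
      · have hev : s ∈ 𝓝 t := Ico_mem_nhds h ht.2
        have h2 : ContDiffOn ℝ 1 (fun t => ‖N t‖) (Ioo a c) :=
          (hNs.mono Ioo_subset_Ico_self).norm ℝ hnes
        have h3 := h2.continuousOn_derivWithin isOpen_Ioo.uniqueDiffOn le_rfl t ⟨h, ht.2⟩
        have h4 : Ioo a c ∈ 𝓝 t := Ioo_mem_nhds h ht.2
        have h5 := h3.continuousAt h4
        refine (h5.congr ?_).continuousWithinAt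
        filter_upwards [h4] with x hx
        rw [derivWithin_of_mem_nhds (Ioo_mem_nhds hx.1 hx.2),
          derivWithin_of_mem_nhds (Ico_mem_nhds hx.1 hx.2)]
  exact (key a has).mono_of_mem_nhdsWithin hsn

theorem euclNorm_sq {l : ℕ} (v : Fin l → ℝ) : euclNorm v ^ 2 = v ⬝ᵥ v := by
  rw [euclNorm, Real.sq_sqrt (Finset.sum_nonneg fun i _ => sq_nonneg _)]
  simp [dotProduct, sq]

theorem euclNorm_nonneg {l : ℕ} (v : Fin l → ℝ) : 0 ≤ euclNorm v := Real.sqrt_nonneg _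

theorem euclNorm_eq {l : ℕ} (v : Fin l → ℝ) : euclNorm v = ‖WithLp.toLp 2 v‖ := by
  simp [euclNorm, EuclideanSpace.norm_eq]

theorem muNorm_nonneg {n l : ℕ} (M : Matrix (Fin n) (Fin l) ℝ) : 0 ≤ muNorm M := by
  apply Real.sInf_nonneg
  rintro _ ⟨v, -, rfl⟩
  exact euclNorm_nonneg _

theorem muNorm_le_unit {n l : ℕ} (M : Matrix (Fin n) (Fin l) ℝ) (v : Fin l → ℝ)
    (hv : euclNorm v = 1) : muNorm M ≤ euclNorm (M *ᵥ v) :=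
  csInf_le ⟨0, by rintro _ ⟨v, -, rfl⟩; exact euclNorm_nonneg _⟩ ⟨v, hv, rfl⟩

theorem euclNorm_smul {l : ℕ} (c : ℝ) (v : Fin l → ℝ) : euclNorm (c • v) = |c| * euclNorm v := by
  rw [euclNorm_eq, euclNorm_eq, WithLp.toLp_smul, norm_smul, Real.norm_eq_abs]

theorem euclNorm_eq_zero {l : ℕ} (v : Fin l → ℝ) : euclNorm v = 0 ↔ v = 0 := by
  rw [euclNorm_eq]; simp

theorem muNorm_le {n l : ℕ} (M : Matrix (Fin n) (Fin l) ℝ) (v : Fin l → ℝ) :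
    muNorm M * euclNorm v ≤ euclNorm (M *ᵥ v) := by
  rcases (euclNorm_nonneg v).eq_or_lt with h | h
  · rw [← h, mul_zero]; exact euclNorm_nonneg _
  · have := muNorm_le_unit M ((euclNorm v)⁻¹ • v) (by
      rw [euclNorm_smul, abs_of_pos (inv_pos.2 h)]; field_simp)
    rw [mulVec_smul, euclNorm_smul, abs_of_pos (inv_pos.2 h)] at this
    rwa [← div_eq_inv_mul, le_div_iff₀ h] at this

theorem continuous_euclNorm {l : ℕ} : Continuous (euclNorm (l := l)) := by
  unfold euclNorm; fun_prop

theorem muNorm_attained {n l : ℕ} (hl : 0 < l) (M : Matrix (Fin n) (Fin l) ℝ) :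
    ∃ v, euclNorm v = 1 ∧ euclNorm (M *ᵥ v) = muNorm M := by
  have hK : IsCompact {v : Fin l → ℝ | euclNorm v = 1} := by
    have : {v : Fin l → ℝ | euclNorm v = 1} =
        (fun v : EuclideanSpace ℝ (Fin l) => WithLp.ofLp v) '' Metric.sphere 0 1 := by
      ext v
      simp only [mem_ofPred_eq, mem_image, mem_sphere_iff_norm, sub_zero]
      constructor
      · intro h; exact ⟨WithLp.toLp 2 v, by rw [← euclNorm_eq]; exact h, rfl⟩
      · rintro ⟨w, hw, rfl⟩; rw [euclNorm_eq]; exact hw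
    rw [this]
    exact (isCompact_sphere _ _).image (PiLp.continuous_ofLp 2 _)
  have hne : {v : Fin l → ℝ | euclNorm v = 1}.Nonempty := by
    refine ⟨Pi.single ⟨0, hl⟩ 1, ?_⟩
    simp [euclNorm_eq]
  obtain ⟨v, hv, h⟩ := hK.exists_sInf_image_eq hne
    (f := fun v => euclNorm (M *ᵥ v)) (by
      refine (continuous_euclNorm.comp ?_).continuousOn
      exact Continuous.matrix_mulVec continuous_const continuous_id)
  exact ⟨v, hv, h.symm⟩

theorem gram_dot {n l : ℕ} (M : Matrix (Fin n) (Fin l) ℝ) (v : Fin l → ℝ) :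
    v ⬝ᵥ ((Mᵀ * M) *ᵥ v) = euclNorm (M *ᵥ v) ^ 2 := by
  rw [euclNorm_sq, ← mulVec_mulVec, dotProduct_mulVec, vecMul_transpose]

theorem muNorm_eig {n l : ℕ} (hl : 0 < l) (M : Matrix (Fin n) (Fin l) ℝ) :
    ∃ v, euclNorm v = 1 ∧ (Mᵀ * M - (muNorm M ^ 2) • (1 : Matrix (Fin l) (Fin l) ℝ)) *ᵥ v = 0 := by
  obtain ⟨v, hv, h⟩ := muNorm_attained hl M
  refine ⟨v, hv, ?_⟩
  have hq : ∀ w : Fin l → ℝ, w ⬝ᵥ ((Mᵀ * M - (muNorm M ^ 2) • (1 : Matrix (Fin l) (Fin l) ℝ)) *ᵥ w)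
      = euclNorm (M *ᵥ w) ^ 2 - (muNorm M * euclNorm w) ^ 2 := by
    intro w
    rw [sub_mulVec, dotProduct_sub, gram_dot, smul_mulVec, one_mulVec, dotProduct_smul, mul_pow,
      euclNorm_sq w, smul_eq_mul]
  have hpsd : (Mᵀ * M - (muNorm M ^ 2) • (1 : Matrix (Fin l) (Fin l) ℝ)).PosSemidef := by
    refine PosSemidef.of_dotProduct_mulVec_nonneg ?_ ?_
    · simp [IsHermitian, conjTranspose_eq_transpose_of_trivial]
    · intro w
      rw [star_trivial, hq, sub_nonneg]
      have := muNorm_le M w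
      have h0 := mul_nonneg (muNorm_nonneg M) (euclNorm_nonneg w)
      gcongr
  rw [← hpsd.dotProduct_mulVec_zero_iff, star_trivial, hq, hv, h]
  ring

theorem det_gram_sub {n l : ℕ} (hl : 0 < l) (M : Matrix (Fin n) (Fin l) ℝ) :
    (Mᵀ * M - (muNorm M ^ 2) • (1 : Matrix (Fin l) (Fin l) ℝ)).det = 0 := by
  obtain ⟨v, hv, h⟩ := muNorm_eig hl M
  refine exists_mulVec_eq_zero_iff.1 ⟨v, ?_, h⟩
  rintro rfl
  rw [(euclNorm_eq_zero _).2 rfl] at hv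
  exact zero_ne_one hv

/-- The function `(M, x) ↦ det (M - x)`. -/
noncomputable def detShift {l : ℕ} (p : (Fin l → Fin l → ℝ) × ℝ) : ℝ :=
  (Matrix.of p.1 - p.2 • (1 : Matrix (Fin l) (Fin l) ℝ)).det

theorem contDiff_det_aux {l : ℕ} {E : Type*} [NormedAddCommGroup E] [NormedSpace ℝ E]
    (F : E → Matrix (Fin l) (Fin l) ℝ) (hF : ∀ i j, ContDiff ℝ 1 (fun x => F x i j)) :
    ContDiff ℝ 1 (fun x => (F x).det) := by
  simp only [det_apply]
  refine ContDiff.sum fun σ _ => ?_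
  refine ContDiff.const_smul _ ?_
  exact contDiff_prod fun i _ => hF _ _

theorem contDiff_entry {l : ℕ} (i j : Fin l) : ContDiff ℝ 1
    (fun p : (Fin l → Fin l → ℝ) × ℝ =>
      (Matrix.of p.1 - p.2 • (1 : Matrix (Fin l) (Fin l) ℝ)) i j) := by
  simp only [Matrix.sub_apply, of_apply, Matrix.smul_apply, smul_eq_mul]
  fun_prop

theorem contDiff_detShift {l : ℕ} : ContDiff ℝ 1 (detShift (l := l)) :=
  contDiff_det_aux _ contDiff_entry

theorem contDiff_adj {l : ℕ} (v : Fin l → ℝ) (i : Fin l) : ContDiff ℝ 1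
    (fun p : (Fin l → Fin l → ℝ) × ℝ =>
      ((Matrix.of p.1 - p.2 • (1 : Matrix (Fin l) (Fin l) ℝ)).adjugate *ᵥ v) i) := by
  simp only [mulVec, dotProduct, adjugate_apply]
  refine ContDiff.sum fun j _ => ContDiff.mul ?_ contDiff_const
  refine contDiff_det_aux _ fun i' j' => ?_
  by_cases h : i' = j
  · subst h; simp only [updateRow_self]; exact contDiff_const
  · simp only [updateRow_ne h]; exact contDiff_entry i' j'

theorem det_sub_eig {l : ℕ} (M : Matrix (Fin l) (Fin l) ℝ) (hM : M.IsHermitian) (x : ℝ) :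
    (M - x • (1 : Matrix (Fin l) (Fin l) ℝ)).det = ∏ i, (hM.eigenvalues i - x) := by
  have h := congrArg (Polynomial.eval x) hM.charpoly_eq
  rw [Matrix.eval_charpoly, Polynomial.eval_prod] at h
  have h2 : M - x • (1 : Matrix (Fin l) (Fin l) ℝ) = -(scalar (Fin l) x - M) := by
    rw [neg_sub, scalar_apply, smul_one_eq_diagonal]
  rw [h2, det_neg, h, ← Finset.card_univ, ← Finset.prod_const, ← Finset.prod_mul_distrib]
  refine Finset.prod_congr rfl fun i _ => ?_
  simp

theorem deriv_det {l : ℕ} (M : Matrix (Fin l) (Fin l) ℝ) (hM : M.IsHermitian) :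
    HasDerivAt (fun x : ℝ => (M - x • (1 : Matrix (Fin l) (Fin l) ℝ)).det)
      (-∑ i, ∏ j ∈ Finset.univ.erase i, hM.eigenvalues j) 0 := by
  simp only [det_sub_eig M hM]
  have := HasDerivAt.fun_finsetProd (u := Finset.univ) (x := (0:ℝ))
    (f := fun i x => hM.eigenvalues i - x) (f' := fun _ => -1)
    (fun i _ => by simpa using (hasDerivAt_id (0:ℝ)).const_sub (hM.eigenvalues i))
  simpa using this

theorem sum_prod_eq {l : ℕ} (e : Fin l → ℝ) (h0 : ∏ i, e i = 0)
    (hK : ∑ i, ∏ j ∈ Finset.univ.erase i, e j ≠ 0) :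
    ∑ i, ∏ j ∈ Finset.univ.erase i, e j = ∏ i ∈ Finset.univ.filter fun i => e i ≠ 0, e i := by
  obtain ⟨i, -, hi⟩ := Finset.exists_ne_zero_of_sum_ne_zero hK
  have hne : ∀ j, j ≠ i → e j ≠ 0 := fun j hj =>
    (Finset.prod_ne_zero_iff.1 hi) j (by simp [hj])
  have hi0 : e i = 0 := by
    obtain ⟨j, -, hj⟩ := Finset.prod_eq_zero_iff.1 h0
    by_contra h
    exact hne j (fun hji => h (hji ▸ hj)) hj
  rw [Finset.sum_eq_single i]
  · congr 1
    ext j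
    simp only [Finset.mem_erase, Finset.mem_univ, and_true, Finset.mem_filter, true_and]
    exact ⟨hne j, fun h hji => h (hji ▸ hi0)⟩
  · intro k _ hk
    exact Finset.prod_eq_zero (i := i) (by simp [hk.symm]) hi0
  · simp

theorem adj_kernel {l : ℕ} (M : Matrix (Fin l) (Fin l) ℝ) (hM : M.IsHermitian) (v : Fin l → ℝ)
    (hv : M *ᵥ v = 0) (h0 : M.det = 0) :
    M.adjugate *ᵥ v = (∑ i, ∏ j ∈ Finset.univ.erase i, hM.eigenvalues j) • v := by
  set K := ∑ i, ∏ j ∈ Finset.univ.erase i, hM.eigenvalues j with hK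
  have hd := deriv_det M hM
  rw [hasDerivAt_iff_tendsto_slope] at hd
  ext i
  have h1 : Tendsto (fun x : ℝ => ((M - x • (1 : Matrix (Fin l) (Fin l) ℝ)).adjugate *ᵥ v) i)
      (𝓝[≠] 0) (𝓝 ((M.adjugate *ᵥ v) i)) := by
    have hc : Continuous (fun x : ℝ =>
        ((M - x • (1 : Matrix (Fin l) (Fin l) ℝ)).adjugate *ᵥ v) i) :=
      (contDiff_adj v i).continuous.comp (f := fun x : ℝ => ((M : Fin l → Fin l → ℝ), x))
        (by fun_prop)
    have := hc.tendsto 0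
    simp only [zero_smul, sub_zero] at this
    exact this.mono_left nhdsWithin_le_nhds
  have h2 := (hd.neg.mul_const (v i))
  refine tendsto_nhds_unique h1 ?_
  rw [← hK, neg_neg] at h2
  refine h2.congr' ?_
  filter_upwards [self_mem_nhdsWithin] with x hx
  have hx : x ≠ 0 := hx
  have h3 : (M - x • (1 : Matrix (Fin l) (Fin l) ℝ)).adjugate *ᵥ
      ((M - x • (1 : Matrix (Fin l) (Fin l) ℝ)) *ᵥ v) =
      (M - x • (1 : Matrix (Fin l) (Fin l) ℝ)).det • v := by
    rw [mulVec_mulVec, adjugate_mul, smul_mulVec, one_mulVec]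
  rw [sub_mulVec, hv, smul_mulVec, one_mulVec, zero_sub, mulVec_neg, mulVec_smul] at h3
  have h4 := congrFun h3 i
  simp only [Pi.neg_apply, Pi.smul_apply, smul_eq_mul] at h4
  simp only [slope, vsub_eq_sub, sub_zero, zero_smul, h0, smul_eq_mul]
  have h5 : x * (-(x⁻¹ * (M - x • (1 : Matrix (Fin l) (Fin l) ℝ)).det) * v i) =
    x * ((M - x • (1 : Matrix (Fin l) (Fin l) ℝ)).adjugate *ᵥ v) i := by
    field_simp; linarith
  exact mul_left_cancel₀ hx h5

theorem ift_aux {E : Type*} [NormedAddCommGroup E] [NormedSpace ℝ E] [FiniteDimensional ℝ E]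
    (D : E × ℝ → ℝ) (hD : ContDiff ℝ 1 D) (m : E) (x₀ : ℝ) (D' : E × ℝ →L[ℝ] ℝ)
    (hD' : HasFDerivAt D D' (m, x₀)) (hne : D' (0, 1) ≠ 0) :
    ∃ g : E × ℝ → ℝ, ContDiffAt ℝ 1 g (m, D (m, x₀)) ∧
      ∀ᶠ p in 𝓝 (m, x₀), g (p.1, D p) = p.2 := by
  have : CompleteSpace E := FiniteDimensional.complete ℝ E
  let L : E × ℝ →L[ℝ] E × ℝ := (ContinuousLinearMap.fst ℝ E ℝ).prod D'
  have hinj : Function.Injective (L : E × ℝ →ₗ[ℝ] E × ℝ) := by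
    rw [← LinearMap.ker_eq_bot, LinearMap.ker_eq_bot']
    rintro ⟨e, x⟩ h
    have h1 : e = 0 := congrArg Prod.fst h
    have h2 : D' (e, x) = 0 := congrArg Prod.snd h
    subst h1
    have h3 : ((0 : E), x) = x • ((0 : E), (1 : ℝ)) := by simp
    rw [h3, map_smul, smul_eq_mul] at h2
    have := (mul_eq_zero.1 h2).resolve_right hne
    simp [this]
  let e : (E × ℝ) ≃L[ℝ] (E × ℝ) :=
    (LinearEquiv.ofInjectiveEndo (L : E × ℝ →ₗ[ℝ] E × ℝ) hinj).toContinuousLinearEquiv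
  have he : (e : E × ℝ →L[ℝ] E × ℝ) = L := by
    apply ContinuousLinearMap.ext
    intro p
    rfl
  have hΦ : ContDiffAt ℝ 1 (fun p : E × ℝ => (p.1, D p)) (m, x₀) :=
    (contDiff_fst.prodMk hD).contDiffAt
  have hΦ' : HasFDerivAt (fun p : E × ℝ => (p.1, D p)) (e : E × ℝ →L[ℝ] E × ℝ) (m, x₀) := by
    rw [he]
    exact hasFDerivAt_fst.prodMk hD'
  refine ⟨fun q => (hΦ.localInverse hΦ' one_ne_zero q).2, ?_, ?_⟩
  · exact contDiff_snd.contDiffAt.comp _ (hΦ.to_localInverse hΦ' one_ne_zero)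
  · have := (hΦ.hasStrictFDerivAt' hΦ' one_ne_zero).eventually_left_inverse
    filter_upwards [this] with p hp
    exact congrArg Prod.snd hp

theorem stmt6 (n l : ℕ) (hln : l ≤ n) (a b : ℝ) (hab : a < b)
    (A : ℝ → Matrix (Fin n) (Fin l) ℝ)
    (hA : ∀ i j, ContDiffOn ℝ 1 (fun t => A t i j) (Set.Icc a b))
    (B : ℝ → Matrix (Fin l) (Fin l) ℝ) (hB : ∀ t, B t = (A t)ᵀ * A t)
    (hdet : ∀ t ∈ Set.Ioo a b, (B t).det ≠ 0)
    (hdeta : (B a).det = 0)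
    (ha : ℝ) (hha : 0 < ha)
    (hasym : (fun t => (B (a + t)).det - ha ^ 2 * t ^ 2) =o[𝓝[>] (0 : ℝ)] fun t => t ^ 2)
    (hHerm : (B a).IsHermitian) :
    ∃ δ > 0, ContDiffOn ℝ 1 (fun t => muNorm (A t)) (Set.Ico a (a + δ)) ∧
      HasDerivWithinAt (fun t => muNorm (A t))
        (ha / Real.sqrt (∏ i ∈ Finset.univ.filter fun i => hHerm.eigenvalues i ≠ 0,
          hHerm.eigenvalues i))
        (Set.Ici a) a := by
  classical
  have hl : 0 < l := by
    rcases Nat.eq_zero_or_pos l with h | h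
    · subst h; simp at hdeta
    · exact h
  have hAI : ∀ i j, ContDiffWithinAt ℝ 1 (fun t => A t i j) (Ici a) a := fun i j =>
    (hA i j a ⟨le_rfl, hab.le⟩).mono_of_mem_nhdsWithin (Icc_mem_nhdsGE hab)
  obtain ⟨Bf, hBf⟩ : ∃ Bf : ℝ → Fin l → Fin l → ℝ, ∀ t i j, Bf t i j = B t i j :=
    ⟨fun t i j => B t i j, fun _ _ _ => rfl⟩
  have hof : ∀ t, Matrix.of (Bf t) = B t := by
    intro t; ext i j; exact hBf t i j
  have hBI : ContDiffWithinAt ℝ 1 (fun t => Bf t) (Ici a) a := by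
    rw [contDiffWithinAt_pi]; intro i
    rw [contDiffWithinAt_pi]; intro j
    simp only [hBf, hB, Matrix.mul_apply, transpose_apply]
    exact ContDiffWithinAt.sum fun k _ => (hAI k i).mul (hAI k j)
  have hAv : ∀ V : ℝ → Fin l → ℝ, (∀ i, ContDiffWithinAt ℝ 1 (fun t => V t i) (Ici a) a) →
      ContDiffWithinAt ℝ 1 (fun t => WithLp.toLp 2 (A t *ᵥ V t)) (Ici a) a := by
    intro V hV
    refine contDiffWithinAt_piLp' _ fun i => ?_
    simp only [mulVec, dotProduct]
    exact ContDiffWithinAt.sum fun k _ => (hAI i k).mul (hV k)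
  obtain ⟨v0, hv0, hBv0⟩ := exists_mulVec_eq_zero_iff.2 hdeta
  have hv0n : 0 < euclNorm v0 := lt_of_le_of_ne (euclNorm_nonneg _)
    (fun h => hv0 ((euclNorm_eq_zero _).1 h.symm))
  have hAv0 : A a *ᵥ v0 = 0 := by
    have := gram_dot (A a) v0
    rw [← hB, hBv0, dotProduct_zero] at this
    exact (euclNorm_eq_zero _).1 (pow_eq_zero_iff two_ne_zero |>.1 this.symm)
  have hmua : muNorm (A a) = 0 := by
    have := muNorm_le (A a) v0
    rw [hAv0, (euclNorm_eq_zero _).2 rfl] at this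
    have h2 := muNorm_nonneg (A a)
    nlinarith
  set lam : ℝ → ℝ := fun t => muNorm (A t) ^ 2 with hlam
  have hlama : lam a = 0 := by simp [hlam, hmua]
  have hmuO : (fun t => muNorm (A t)) =O[𝓝[≥] a] fun t => t - a := by
    have h1 := ((hAv (fun _ => v0) (fun i => contDiffWithinAt_const)).differentiableWithinAt
      one_ne_zero).isBigO_sub
    simp only [hAv0, WithLp.toLp_zero, sub_zero] at h1
    refine IsBigO.trans ?_ h1
    refine IsBigO.of_bound (euclNorm v0)⁻¹ (Eventually.of_forall fun t => ?_)
    rw [Real.norm_eq_abs, abs_of_nonneg (muNorm_nonneg _), ← euclNorm_eq, ← div_eq_inv_mul,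
      le_div_iff₀ hv0n]
    exact muNorm_le _ _
  have hlamO : lam =O[𝓝[≥] a] fun t => (t - a) ^ 2 := hmuO.pow 2
  have hid0 : Tendsto (fun t : ℝ => t - a) (𝓝[≥] a) (𝓝 0) := by
    have : Tendsto (fun t : ℝ => t - a) (𝓝 a) (𝓝 (a - a)) := by
      exact (continuous_id.sub continuous_const).tendsto a
    rw [sub_self] at this
    exact this.mono_left nhdsWithin_le_nhds
  have hlam0 : Tendsto lam (𝓝[≥] a) (𝓝 0) :=
    hlamO.trans_tendsto (by simpa using hid0.pow 2)
  have hBt : Tendsto (fun t => Bf t) (𝓝[≥] a) (𝓝 (Bf a)) :=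
    hBI.continuousWithinAt
  have hdl : ∀ t, detShift (Bf t, lam t) = 0 := by
    intro t
    have := det_gram_sub hl (A t)
    rw [← hB] at this
    rw [detShift, hof]
    exact this
  have hd0 : ∀ t, detShift (Bf t, 0) = (B t).det := by
    intro t
    simp [detShift, hof]
  set K := ∑ i, ∏ j ∈ Finset.univ.erase i, hHerm.eigenvalues j with hK
  obtain ⟨D', hS⟩ : ∃ D', HasStrictFDerivAt (detShift (l := l)) D' ((Bf a), 0) :=
    ⟨_, contDiff_detShift.contDiffAt.hasStrictFDerivAt one_ne_zero⟩
  have hD'1 : D' (0, 1) = -K := by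
    have h1 : HasDerivAt (fun x : ℝ => ((Bf a), x)) (0, 1) 0 :=
      (hasDerivAt_const _ _).prodMk (hasDerivAt_id _)
    have h2 := HasFDerivAt.comp_hasDerivAt (0 : ℝ) hS.hasFDerivAt h1
    have h3 : (detShift ∘ fun x : ℝ => (Bf a, x)) =
        fun x : ℝ => (B a - x • (1 : Matrix (Fin l) (Fin l) ℝ)).det := by
      funext x
      simp only [Function.comp, detShift, hof]
    rw [h3] at h2
    exact h2.unique (deriv_det (B a) hHerm)
  have hdetlam : (fun t => (B t).det - K * lam t) =o[𝓝[≥] a] lam := by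
    have h1 : Tendsto (fun t => ((Bf t, (0 : ℝ)),
        (Bf t, lam t))) (𝓝[≥] a)
        (𝓝 (((Bf a), (0 : ℝ)), ((Bf a), (0 : ℝ)))) :=
      (hBt.prodMk_nhds tendsto_const_nhds).prodMk_nhds (hBt.prodMk_nhds hlam0)
    have h2 := hS.isLittleO.comp_tendsto h1
    refine (h2.congr_left ?_).trans_isBigO ?_
    · intro t
      simp only [Function.comp, hdl, hd0, Prod.mk_sub_mk, sub_self, zero_sub, sub_zero]
      have h3 : ((0 : Fin l → Fin l → ℝ), -lam t) = (-lam t) • ((0 : Fin l → Fin l → ℝ), (1 : ℝ)) := by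
        simp
      rw [h3, map_smul, hD'1, smul_eq_mul]; ring
    · refine IsBigO.of_bound 1 (Eventually.of_forall fun t => ?_)
      simp [Function.comp]
  have hasym' : (fun t => (B t).det - ha ^ 2 * (t - a) ^ 2) =o[𝓝[>] a] fun t => (t - a) ^ 2 := by
    have h1 : Tendsto (fun t : ℝ => t - a) (𝓝[>] a) (𝓝[>] 0) := by
      refine tendsto_nhdsWithin_iff.2 ⟨hid0.mono_left (nhdsWithin_mono _ Ioi_subset_Ici_self), ?_⟩
      filter_upwards [self_mem_nhdsWithin] with t ht
      exact mem_Ioi.2 (sub_pos.2 (mem_Ioi.1 ht))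
    have h2 := hasym.comp_tendsto h1
    refine (h2.congr_left ?_)
    intro t
    simp [Function.comp]
  have hKl : (fun t => K * lam t - ha ^ 2 * (t - a) ^ 2) =o[𝓝[>] a] fun t => (t - a) ^ 2 := by
    have h1 : (fun t => (B t).det - K * lam t) =o[𝓝[>] a] fun t => (t - a) ^ 2 :=
      (hdetlam.trans_isBigO hlamO).mono (nhdsWithin_mono _ Ioi_subset_Ici_self)
    refine (hasym'.sub h1).congr_left fun t => ?_
    ring
  have hKlim : Tendsto (fun t => K * lam t / (t - a) ^ 2) (𝓝[>] a) (𝓝 (ha ^ 2)) := by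
    have h1 := hKl.tendsto_div_nhds_zero.add_const (ha ^ 2)
    rw [zero_add] at h1
    refine h1.congr' ?_
    filter_upwards [self_mem_nhdsWithin] with t ht
    have : t - a ≠ 0 := (sub_pos.2 ht).ne'
    field_simp
    ring
  have hKpos : 0 < K := by
    have h1 := hKlim.eventually (lt_mem_nhds (show 0 < ha ^ 2 by positivity))
    obtain ⟨t, ht, hta⟩ := (h1.and self_mem_nhdsWithin).exists
    by_contra hneg
    have h2 : 0 ≤ lam t := sq_nonneg _
    have h3 : K * lam t / (t - a) ^ 2 ≤ 0 :=
      div_nonpos_of_nonpos_of_nonneg (mul_nonpos_of_nonpos_of_nonneg (not_lt.1 hneg) h2)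
        (sq_nonneg _)
    linarith
  have hKeq : K = ∏ i ∈ Finset.univ.filter fun i => hHerm.eigenvalues i ≠ 0,
      hHerm.eigenvalues i := by
    refine sum_prod_eq _ ?_ hKpos.ne'
    have := hHerm.det_eq_prod_eigenvalues
    rw [hdeta] at this
    simpa using this.symm
  have hmulim : Tendsto (fun t => (t - a)⁻¹ * muNorm (A t)) (𝓝[>] a) (𝓝 (ha / Real.sqrt K)) := by
    have h1 := (hKlim.div_const K).sqrt
    rw [Real.sqrt_div (by positivity), Real.sqrt_sq hha.le] at h1
    refine h1.congr' ?_
    filter_upwards [self_mem_nhdsWithin] with t ht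
    have hp : 0 < t - a := sub_pos.2 ht
    have h2 : K * lam t / (t - a) ^ 2 / K = ((t - a)⁻¹ * muNorm (A t)) ^ 2 := by
      simp only [hlam]; field_simp
    rw [h2, Real.sqrt_sq (mul_nonneg (inv_pos.2 hp).le (muNorm_nonneg _))]
  have hderiv : HasDerivWithinAt (fun t => muNorm (A t)) (ha / Real.sqrt K) (Ici a) a := by
    rw [hasDerivWithinAt_iff_tendsto_slope, Ici_sdiff_left]
    refine hmulim.congr fun t => ?_
    simp [slope, hmua]
  obtain ⟨g, hg, hgl⟩ := ift_aux (detShift (l := l)) contDiff_detShift (Bf a) 0 D'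
    hS.hasFDerivAt (by rw [hD'1]; exact neg_ne_zero.2 hKpos.ne')
  have hlamC : ContDiffWithinAt ℝ 1 lam (Ici a) a := by
    have hd00 : detShift ((Bf a), (0 : ℝ)) = 0 := (hd0 a).trans hdeta
    rw [hd00] at hg
    have h1 : ContDiffWithinAt ℝ 1 (fun t => g (Bf t, 0)) (Ici a) a :=
      ContDiffAt.comp_contDiffWithinAt (f := fun t => (Bf t, (0 : ℝ))) a hg
        (hBI.prodMk contDiffWithinAt_const)
    have h2 : lam =ᶠ[𝓝[≥] a] fun t => g (Bf t, 0) := by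
      filter_upwards [(hBt.prodMk_nhds hlam0).eventually hgl] with t ht
      rw [hdl] at ht
      exact ht.symm
    exact h1.congr_of_eventuallyEq h2 (h2.self_of_nhdsWithin self_mem_Ici)
  set V : ℝ → Fin l → ℝ := fun t =>
    (B t - lam t • (1 : Matrix (Fin l) (Fin l) ℝ)).adjugate *ᵥ v0 with hV
  have hVC : ∀ i, ContDiffWithinAt ℝ 1 (fun t => V t i) (Ici a) a := by
    intro i
    have h1 := ContDiffAt.comp_contDiffWithinAt (f := fun t => (Bf t, lam t)) a
      (contDiff_adj v0 i).contDiffAt (hBI.prodMk hlamC)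
    simpa only [Function.comp_def, hof] using h1
  have hVa : V a = K • v0 := by
    simp only [hV, hlama, zero_smul, sub_zero]
    exact adj_kernel (B a) hHerm v0 hBv0 hdeta
  have hVa0 : V a ≠ 0 := by
    rw [hVa]; exact smul_ne_zero hKpos.ne' hv0
  have hVLC : ContDiffWithinAt ℝ 1 (fun t => WithLp.toLp 2 (V t)) (Ici a) a :=
    contDiffWithinAt_piLp' _ hVC
  have hVN : ContDiffWithinAt ℝ 1 (fun t => ‖WithLp.toLp 2 (V t)‖) (Ici a) a :=
    hVLC.norm ℝ (by simpa using hVa0)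
  have hNmu : ∀ t, ‖WithLp.toLp 2 (A t *ᵥ V t)‖ = muNorm (A t) * ‖WithLp.toLp 2 (V t)‖ := by
    intro t
    rw [← euclNorm_eq, ← euclNorm_eq]
    have h1 : (B t - lam t • (1 : Matrix (Fin l) (Fin l) ℝ)) *ᵥ V t = 0 := by
      have h2 : (B t - lam t • (1 : Matrix (Fin l) (Fin l) ℝ)).det = 0 := by
        simpa only [detShift, hof] using hdl t
      simp only [hV]
      rw [mulVec_mulVec, mul_adjugate, h2, zero_smul, zero_mulVec]
    rw [sub_mulVec, smul_mulVec, one_mulVec, sub_eq_zero] at h1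
    have h3 := gram_dot (A t) (V t)
    rw [← hB, h1, dotProduct_smul, ← euclNorm_sq, smul_eq_mul] at h3
    have h4 : euclNorm (A t *ᵥ V t) ^ 2 = (muNorm (A t) * euclNorm (V t)) ^ 2 := by
      rw [← h3, mul_pow]
    exact (sq_eq_sq₀ (euclNorm_nonneg _)
      (mul_nonneg (muNorm_nonneg _) (euclNorm_nonneg _))).1 h4
  have hNC := hAv V hVC
  have hVn0 : ‖WithLp.toLp 2 (V a)‖ ≠ 0 := by simpa using hVa0
  have hNnC : ContDiffWithinAt ℝ 1 (fun t => ‖WithLp.toLp 2 (A t *ᵥ V t)‖) (Ici a) a := by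
    refine norm_c1 _ a hNC ?_ ?_
    · rw [hVa, mulVec_smul, hAv0]; simp
    · intro h
      have hN0 : WithLp.toLp 2 (A a *ᵥ V a) = 0 := by
        rw [hVa, mulVec_smul, hAv0]; simp
      rw [hasDerivWithinAt_iff_tendsto_slope, Ici_sdiff_left] at h
      have h1 := h.norm
      have h2 := hmulim.mul ((hVN.continuousWithinAt).mono_left
        (nhdsWithin_mono a Ioi_subset_Ici_self))
      have h3 := tendsto_nhds_unique (h1.congr' ?_) h2
      · rw [norm_zero] at h3
        have : 0 < ha / Real.sqrt K := div_pos hha (Real.sqrt_pos.2 hKpos)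
        exact (mul_ne_zero this.ne' hVn0) h3.symm
      · filter_upwards [self_mem_nhdsWithin] with t ht
        have hp : 0 < t - a := sub_pos.2 ht
        simp only [slope, vsub_eq_sub, hN0, sub_zero]
        rw [norm_smul, hNmu, norm_inv, Real.norm_eq_abs, abs_of_pos hp, mul_assoc]
  have hmuC : ContDiffWithinAt ℝ 1 (fun t => muNorm (A t)) (Ici a) a := by
    have h1 := hNnC.div hVN hVn0
    have hev : ∀ᶠ t in 𝓝[≥] a, ‖WithLp.toLp 2 (V t)‖ ≠ 0 :=
      hVN.continuousWithinAt.eventually_ne hVn0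
    have h2 : (fun t => muNorm (A t)) =ᶠ[𝓝[≥] a] fun t =>
        ‖WithLp.toLp 2 (A t *ᵥ V t)‖ / ‖WithLp.toLp 2 (V t)‖ := by
      filter_upwards [hev] with t ht
      rw [hNmu]; field_simp
    exact h1.congr_of_eventuallyEq h2 (h2.self_of_nhdsWithin self_mem_Ici)
  obtain ⟨u, hu, -, hmu⟩ := hmuC.contDiffOn (m := 1) le_rfl (by simp)
  rw [insert_eq_of_mem self_mem_Ici] at hu
  obtain ⟨c, hc, hcu⟩ := mem_nhdsGE_iff_exists_Ico_subset.1 hu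
  refine ⟨c - a, sub_pos.2 hc, ?_, ?_⟩
  · rw [add_sub_cancel]
    exact hmu.mono hcu
  · rw [← hKeq]
    exact hderiv
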